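/- arXiv:2501.11504 — 2 statements merged into one kernel-verified Lean document; each statement's English description precedes it below -/
import Mathlib

section
/- Let G be a finite group, (A,α) an algebra with G-action, n any index set, and S an arbitrary G-action on the standard right functional A-module A^n (so (A^n, S, Θ = A^n) is a G-equivariant functional (A,α)-module). Then there exist: a linear G-action ν on ℂ^{n·|G|}; a G-equivariant functional extension π : (A^n, S) → A^{n·|G|} = (A ⊗ ℂ^{n·|G|}, α ⊗ ν); a linear G-action μ on ℂ^{|G|}; and a G-equivariant isomorphism of functional modules (V, V^*) : (A ⊗ ℂ^{n·|G|}, α ⊗ ν) → (A^n ⊗ ℂ^{|G|}, S ⊗ μ) (i.e., a homomorphism of functional modules with both V and V^* bijective), such that V ∘ π is the canonical embedding of A^n onto the first summand A^n ⊗ ℂ·e_1 of A^n ⊗ ℂ^{|G|}. -/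
open scoped BigOperators TensorProduct

noncomputable section

/-- A right module structure for a (not necessarily unital) ℂ-algebra `A`
on a ℂ-vector space `E`. -/
structure RightMod (A : Type*) [NonUnitalRing A] [Module ℂ A]
    (E : Type*) [AddCommGroup E] [Module ℂ E] where
  sm : E → A → E
  add_sm : ∀ (x y : E) (a : A), sm (x + y) a = sm x a + sm y a
  sm_add : ∀ (x : E) (a b : A), sm x (a + b) = sm x a + sm x b
  sm_mul : ∀ (x : E) (a b : A), sm (sm x a) b = sm x (a * b)
  csm_left : ∀ (c : ℂ) (x : E) (a : A), sm (c • x) a = c • sm x a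
  csm_right : ∀ (c : ℂ) (x : E) (a : A), sm x (c • a) = c • sm x a

variable {A : Type*} [NonUnitalRing A] [Module ℂ A]

/-- `f : E → A` is a right `A`-module homomorphism into the standard module `A`. -/
def IsFunctional {E : Type*} [AddCommGroup E] [Module ℂ E]
    (r : RightMod A E) (f : E → A) : Prop :=
  (∀ x y : E, f (x + y) = f x + f y) ∧ (∀ (c : ℂ) (x : E), f (c • x) = c • f x) ∧
    ∀ (x : E) (a : A), f (r.sm x a) = f x * a

/-- `Θ` is a functional space for the right `A`-module `(E, r)`:
a `G`-invariant left `A`-submodule of `Hom_A(E,A)`. -/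
structure IsFunctionalSpace {E : Type*} [AddCommGroup E] [Module ℂ E]
    (r : RightMod A E) (Θ : Set (E → A)) : Prop where
  functional : ∀ φ ∈ Θ, IsFunctional r φ
  zero_mem : (0 : E → A) ∈ Θ
  add_mem : ∀ {φ ψ : E → A}, φ ∈ Θ → ψ ∈ Θ → φ + ψ ∈ Θ
  neg_mem : ∀ {φ : E → A}, φ ∈ Θ → -φ ∈ Θ
  csmul_mem : ∀ (c : ℂ) {φ : E → A}, φ ∈ Θ → c • φ ∈ Θ
  lsmul_mem : ∀ (a : A) {φ : E → A}, φ ∈ Θ → (fun x => a * φ x) ∈ Θ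

/-- Right `A`-module homomorphism between two right `A`-modules. -/
def IsModHom {E F : Type*} [AddCommGroup E] [Module ℂ E] [AddCommGroup F] [Module ℂ F]
    (rE : RightMod A E) (rF : RightMod A F) (U : E → F) : Prop :=
  (∀ x y : E, U (x + y) = U x + U y) ∧ (∀ (c : ℂ) (x : E), U (c • x) = c • U x) ∧
    ∀ (x : E) (a : A), U (rE.sm x a) = rF.sm (U x) a

/-- A homomorphism of functional modules `(U, U^*)`. -/
structure IsFunctionalHom {E F : Type*} [AddCommGroup E] [Module ℂ E]
    [AddCommGroup F] [Module ℂ F]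
    (rE : RightMod A E) (ΘE : Set (E → A)) (rF : RightMod A F) (ΘF : Set (F → A))
    (U : E → F) (Ustar : (E → A) → F → A) : Prop where
  hom : IsModHom rE rF U
  maps_mem : ∀ {φ : E → A}, φ ∈ ΘE → Ustar φ ∈ ΘF
  star_add : ∀ {φ ψ : E → A}, φ ∈ ΘE → ψ ∈ ΘE → Ustar (φ + ψ) = Ustar φ + Ustar ψ
  star_csmul : ∀ (c : ℂ) {φ : E → A}, φ ∈ ΘE → Ustar (c • φ) = c • Ustar φ
  star_lsmul : ∀ (a : A) {φ : E → A}, φ ∈ ΘE →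
      Ustar (fun x => a * φ x) = fun y => a * Ustar φ y
  compat : ∀ {φ : E → A}, φ ∈ ΘE → ∀ x : E, Ustar φ (U x) = φ x

/-- A functional extension. -/
structure IsFunctionalExtension {E F : Type*} [AddCommGroup E] [Module ℂ E]
    [AddCommGroup F] [Module ℂ F]
    (rE : RightMod A E) (ΘE : Set (E → A)) (rF : RightMod A F) (ΘF : Set (F → A))
    (U : E → F) (Ustar : (E → A) → F → A)
    extends IsFunctionalHom rE ΘE rF ΘF U Ustar : Prop where
  inj : Function.Injective U
  lift : ∀ (k : ℕ) (φ : Fin k → E → A), (∀ i, φ i ∈ ΘE) → ∀ η : F,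
      ∃ ξ : E, ∀ i, Ustar (φ i) η = φ i ξ

/-- The elementary compact operator `θ_{η,φ}`. -/
def elemOp {E : Type*} [AddCommGroup E] [Module ℂ E]
    (r : RightMod A E) (η : E) (φ : E → A) : E → E :=
  fun ξ => r.sm η (φ ξ)

/-- The set of compact operators on `(E, r, Θ)`: finite sums of elementary operators. -/
def KSet {E : Type*} [AddCommGroup E] [Module ℂ E]
    (r : RightMod A E) (Θ : Set (E → A)) : Set (E → E) :=
  { T | ∃ (m : ℕ) (η : Fin m → E) (φ : Fin m → E → A),
      (∀ i, φ i ∈ Θ) ∧ T = ∑ i, elemOp r (η i) (φ i) }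

end

/-- A `G`-action on the algebra `A` by (ℂ-linear) algebra automorphisms. -/
structure AlgAction (G : Type*) [Group G] (A : Type*) [NonUnitalRing A] [Module ℂ A] where
  act : G → A → A
  map_add : ∀ (g : G) (x y : A), act g (x + y) = act g x + act g y
  map_mul : ∀ (g : G) (x y : A), act g (x * y) = act g x * act g y
  map_csmul : ∀ (g : G) (c : ℂ) (x : A), act g (c • x) = c • act g x
  act_one : ∀ x : A, act 1 x = x
  act_mul : ∀ (g h : G) (x : A), act (g * h) x = act g (act h x)

/-- A `G`-action on a right `A`-module compatible with the action `α` on `A`. -/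
structure ModAction (G : Type*) [Group G] {A E : Type*} [NonUnitalRing A] [Module ℂ A]
    [AddCommGroup E] [Module ℂ E] (α : AlgAction G A) (r : RightMod A E) where
  act : G → E → E
  map_add : ∀ (g : G) (x y : E), act g (x + y) = act g x + act g y
  map_csmul : ∀ (g : G) (c : ℂ) (x : E), act g (c • x) = c • act g x
  act_sm : ∀ (g : G) (x : E) (a : A), act g (r.sm x a) = r.sm (act g x) (α.act g a)
  act_one : ∀ x : E, act 1 x = x
  act_mul : ∀ (g h : G) (x : E), act (g * h) x = act g (act h x)

/-- A linear `G`-action on a ℂ-vector space. -/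
structure LinAction (G : Type*) [Group G] (V : Type*) [AddCommGroup V] [Module ℂ V] where
  act : G → V → V
  map_add : ∀ (g : G) (x y : V), act g (x + y) = act g x + act g y
  map_csmul : ∀ (g : G) (c : ℂ) (x : V), act g (c • x) = c • act g x
  act_one : ∀ x : V, act 1 x = x
  act_mul : ∀ (g h : G) (x : V), act (g * h) x = act g (act h x)

/-- Invariance of a functional space under the induced action `g(φ) = α_g ∘ φ ∘ S_{g⁻¹}`. -/
def ThetaInvariant {G A E : Type*} [Group G] [NonUnitalRing A] [Module ℂ A]
    [AddCommGroup E] [Module ℂ E] {r : RightMod A E}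
    (α : AlgAction G A) (S : ModAction G α r) (Θ : Set (E → A)) : Prop :=
  ∀ g : G, ∀ φ ∈ Θ, (fun ξ => α.act g (φ (S.act g⁻¹ ξ))) ∈ Θ

section Std

variable (A : Type*) [NonUnitalRing A] [Module ℂ A] [SMulCommClass ℂ A A] [IsScalarTower ℂ A A]

/-- The standard right functional `A`-module structure on `A^n = n →₀ A`
(finitely supported families). -/
noncomputable def stdMod (n : Type*) : RightMod A (n →₀ A) where
  sm x a := Finsupp.mapRange (· * a) (zero_mul a) x
  add_sm x y a := by ext i; simp [add_mul]
  sm_add x a b := by ext i; simp [mul_add]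
  sm_mul x a b := by ext i; simp [mul_assoc]
  csm_left c x a := by ext i; simp [smul_mul_assoc]
  csm_right c x a := by ext i; simp [mul_smul_comm]

/-- The standard functional space on `A^n`: the vectors `x ∈ A^n` acting by
`x(ξ) = Σ_i x_i * ξ_i`. -/
def stdTheta (n : Type*) : Set ((n →₀ A) → A) :=
  { f | ∃ x : n →₀ A, ∀ ξ : n →₀ A, f ξ = x.sum fun i xi => xi * ξ i }

end Std

section Units

variable (A : Type*) [NonUnitalRing A]

/-- `A` has a left approximate unit (discrete version: finitely many elements
admit a simultaneous left unit). -/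
def HasLeftApproxUnit : Prop :=
  ∀ (m : ℕ) (a : Fin m → A), ∃ u : A, ∀ i, u * a i = a i

/-- `A` has a right approximate unit. -/
def HasRightApproxUnit : Prop :=
  ∀ (m : ℕ) (a : Fin m → A), ∃ u : A, ∀ i, a i * u = a i

/-- `A` has a two-sided approximate unit. -/
def HasTwoSidedApproxUnit : Prop :=
  ∀ (m : ℕ) (a : Fin m → A), ∃ u : A, ∀ i, u * a i = a i ∧ a i * u = a i

end Units

section KUnits

variable {A E : Type*} [NonUnitalRing A] [Module ℂ A] [AddCommGroup E] [Module ℂ E]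

/-- The algebra of compact operators of `(E, r, Θ)` has a left approximate unit
(multiplication being composition of operators). -/
def KSetHasLeftApproxUnit (r : RightMod A E) (Θ : Set (E → A)) : Prop :=
  ∀ (m : ℕ) (T : Fin m → E → E), (∀ i, T i ∈ KSet r Θ) →
    ∃ u ∈ KSet r Θ, ∀ i, u ∘ T i = T i

/-- The algebra of compact operators of `(E, r, Θ)` has a right approximate unit. -/
def KSetHasRightApproxUnit (r : RightMod A E) (Θ : Set (E → A)) : Prop :=
  ∀ (m : ℕ) (T : Fin m → E → E), (∀ i, T i ∈ KSet r Θ) →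
    ∃ u ∈ KSet r Θ, ∀ i, T i ∘ u = T i

/-- The algebra of compact operators of `(E, r, Θ)` has a two-sided approximate unit. -/
def KSetHasTwoSidedApproxUnit (r : RightMod A E) (Θ : Set (E → A)) : Prop :=
  ∀ (m : ℕ) (T : Fin m → E → E), (∀ i, T i ∈ KSet r Θ) →
    ∃ u ∈ KSet r Θ, ∀ i, u ∘ T i = T i ∧ T i ∘ u = T i

end KUnits

section Cofull

variable {A E : Type*} [NonUnitalRing A] [Module ℂ A] [AddCommGroup E] [Module ℂ E]

/-- The functional module `E` is cofull. -/
def CofullModule (r : RightMod A E) (Θ : Set (E → A)) : Prop :=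
  ∀ x : E, ∃ (m : ℕ) (ξ η : Fin m → E) (φ : Fin m → E → A),
    (∀ i, φ i ∈ Θ) ∧ x = ∑ i, r.sm (ξ i) (φ i (η i))

/-- The functional space `Θ` is cofull. -/
def CofullTheta (r : RightMod A E) (Θ : Set (E → A)) : Prop :=
  ∀ τ' ∈ Θ, ∃ (m : ℕ) (ξ : Fin m → E) (φ τ : Fin m → E → A),
    (∀ i, φ i ∈ Θ) ∧ (∀ i, τ i ∈ Θ) ∧ τ' = ∑ i, fun x => φ i (ξ i) * τ i x

end Cofull

section Pi

variable {A E : Type*} [NonUnitalRing A] [Module ℂ A] [AddCommGroup E] [Module ℂ E]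

/-- The `G`-fold direct product of copies of a right `A`-module (pointwise
structure); for finite `G` this is the direct sum `⊕_{g ∈ G} E`. -/
def piMod (r : RightMod A E) (G : Type*) : RightMod A (G → E) where
  sm x a := fun g => r.sm (x g) a
  add_sm x y a := by funext g; simp [r.add_sm]
  sm_add x a b := by funext g; simp [r.sm_add]
  sm_mul x a b := by funext g; simp [r.sm_mul]
  csm_left c x a := by funext g; simp [r.csm_left]
  csm_right c x a := by funext g; simp [r.csm_right]

/-- The functional space of the finite direct sum `⊕_{g ∈ G} E`. -/
def piTheta (G : Type*) [Fintype G] (Θ : Set (E → A)) : Set ((G → E) → A) :=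
  { f | ∃ χ : G → E → A, (∀ g, χ g ∈ Θ) ∧ ∀ x : G → E, f x = ∑ g : G, χ g (x g) }

end Pi

set_option linter.unusedSectionVars false

noncomputable section

namespace EquivariantStabilization

section Matrix

variable {G M N : Type*} [Fintype G] [AddCommGroup M] [Module ℂ M] [AddCommGroup N] [Module ℂ N]

/-- The action of a scalar matrix on `G → M = M ⊗ ℂ^G`. -/
def mix (c : Matrix G G ℂ) : (G → M) →ₗ[ℂ] (G → M) where
  toFun y := fun g => ∑ h, c g h • y h
  map_add' x y := by funext g; simp [Finset.sum_add_distrib]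
  map_smul' t x := by
    funext g
    simp only [Pi.smul_apply, Finset.smul_sum, RingHom.id_apply]
    exact Finset.sum_congr rfl fun h _ => smul_comm _ _ _

theorem mix_apply (c : Matrix G G ℂ) (y : G → M) (g : G) : mix c y g = ∑ h, c g h • y h := rfl

theorem mix_mul (c d : Matrix G G ℂ) (y : G → M) : mix (c * d) y = mix c (mix d y) := by
  funext g
  simp only [mix_apply, Matrix.mul_apply, Finset.sum_smul, Finset.smul_sum, mul_smul]
  exact Finset.sum_comm

theorem mix_map (c : Matrix G G ℂ) (F : M →ₗ[ℂ] N) (y : G → M) :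
    mix c (fun h => F (y h)) = fun h => F (mix c y h) := by
  funext g
  simp [mix_apply]

variable [DecidableEq G]

theorem mix_one (y : G → M) : mix (1 : Matrix G G ℂ) y = y := by
  funext g
  simp [mix_apply, Matrix.one_apply]

theorem mix_ite (c : Matrix G G ℂ) (h : G) (x : M) :
    mix c (fun k => if k = h then x else 0) = fun g => c g h • x := by
  funext g
  simp [mix_apply]

/-- An invertible matrix acts by a linear automorphism. -/
def mixEquiv (c d : Matrix G G ℂ) (h : c * d = 1) : (G → M) ≃ₗ[ℂ] (G → M) where
  __ := mix c
  invFun := mix d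
  left_inv y := by
    change mix d (mix c y) = y
    rw [← mix_mul, mul_eq_one_comm.mp h, mix_one]
  right_inv y := by
    change mix c (mix d y) = y
    rw [← mix_mul, h, mix_one]

variable [Group G]

/-- The matrix of the left regular representation. -/
def regMatrix (g : G) : Matrix G G ℂ := fun h k => if k = g⁻¹ * h then 1 else 0

theorem mix_regMatrix (g : G) (y : G → M) : mix (regMatrix g) y = fun h => y (g⁻¹ * h) := by
  funext h
  simp [mix_apply, regMatrix]

theorem regMatrix_one : regMatrix (1 : G) = 1 := by
  ext h k
  simp [regMatrix, Matrix.one_apply, eq_comm]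

theorem regMatrix_mul (g h : G) : regMatrix (g * h) = regMatrix g * regMatrix h := by
  ext i j
  rw [Matrix.mul_apply, Finset.sum_eq_single (g⁻¹ * i)]
  · simp [regMatrix, mul_assoc]
  · intro k _ hk
    simp [regMatrix, hk]
  · simp

variable (G) in
/-- A change of basis of `ℂ^G` whose first coordinate is the average. -/
def avgMatrix : Matrix G G ℂ := fun k h =>
  if k = 1 then (Fintype.card G : ℂ)⁻¹ else (if h = k then 1 else 0) - (Fintype.card G : ℂ)⁻¹

variable (G) in
/-- The inverse of `avgMatrix`; its first column is the constant vector. -/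
def avgMatrixInv : Matrix G G ℂ := fun k h =>
  (if h = 1 then 1 else 0) + if k = 1 then (if h = 1 then 1 else 0) - 1 else if h = k then 1 else 0

variable (G) in
theorem avgMatrixInv_mul : avgMatrixInv G * avgMatrix G = 1 := by
  have hG : (Fintype.card G : ℂ) ≠ 0 := Nat.cast_ne_zero.mpr Fintype.card_ne_zero
  have key (h : G) : ∑ k, avgMatrix G k h =
      2 * (Fintype.card G : ℂ)⁻¹ - if h = 1 then 1 else 0 := by
    have h1 (k : G) : avgMatrix G k h = (if h = k then 1 else 0) - (Fintype.card G : ℂ)⁻¹ +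
        if k = 1 then 2 * (Fintype.card G : ℂ)⁻¹ - if h = 1 then 1 else 0 else 0 := by
      by_cases hk : k = 1
      · simp only [avgMatrix, hk, if_true]
        ring
      · simp [avgMatrix, hk]
    simp only [h1, Finset.sum_add_distrib, Finset.sum_sub_distrib, Finset.sum_ite_eq,
      Finset.sum_ite_eq', Finset.mem_univ, if_true, Finset.sum_const, Finset.card_univ,
      nsmul_eq_mul, mul_inv_cancel₀ hG]
    ring
  ext i j
  rw [Matrix.mul_apply, Matrix.one_apply]
  by_cases hi : i = 1
  · have h2 (k : G) : avgMatrixInv G i k * avgMatrix G k j =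
        (if k = 1 then 2 * avgMatrix G k j else 0) - avgMatrix G k j := by
      by_cases hk : k = 1
      · simp only [avgMatrixInv, hi, hk, if_true]
        ring
      · simp [avgMatrixInv, hi, hk]
    simp only [h2, Finset.sum_sub_distrib, key, Finset.sum_ite_eq', Finset.mem_univ, if_true]
    simp [avgMatrix, hi, eq_comm]
  · have h2 (k : G) : avgMatrixInv G i k * avgMatrix G k j =
        (if k = 1 then avgMatrix G k j else 0) + if k = i then avgMatrix G k j else 0 := by
      simp [avgMatrixInv, hi, add_mul]
    simp only [h2, Finset.sum_add_distrib, Finset.sum_ite_eq', Finset.mem_univ, if_true]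
    simp [avgMatrix, hi, eq_comm]

variable (G) in
theorem avgMatrix_mul : avgMatrix G * avgMatrixInv G = 1 :=
  mul_eq_one_comm.mp (avgMatrixInv_mul G)

/-- The regular representation in a basis whose first vector is invariant. -/
def rep (g : G) : Matrix G G ℂ := avgMatrix G * regMatrix g * avgMatrixInv G

theorem rep_one : rep (1 : G) = 1 := by
  rw [rep, regMatrix_one, mul_one, avgMatrix_mul]

theorem rep_mul (g h : G) : rep (g * h) = rep g * rep h := by
  have : rep g * rep h =
      avgMatrix G * regMatrix g * (avgMatrixInv G * avgMatrix G) * regMatrix h * avgMatrixInv G := by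
    simp only [rep, mul_assoc]
  rw [this, avgMatrixInv_mul, rep, regMatrix_mul]
  simp only [mul_assoc, one_mul]

theorem rep_apply_one (g h : G) : rep g h 1 = if h = 1 then 1 else 0 := by
  have h1 (k : G) : (regMatrix g * avgMatrixInv G) k 1 = avgMatrixInv G (g⁻¹ * k) 1 := by
    simp [Matrix.mul_apply, regMatrix]
  have h2 (k : G) : avgMatrixInv G k 1 = 1 := by
    by_cases hk : k = 1 <;> simp [avgMatrixInv, hk, eq_comm]
  have h3 := congrFun (congrFun (avgMatrix_mul G) h) 1
  rw [Matrix.mul_apply, Matrix.one_apply] at h3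
  rw [rep, mul_assoc, Matrix.mul_apply, ← h3]
  simp [h1, h2]

theorem rep_one_apply (g h : G) : rep g 1 h = if h = 1 then 1 else 0 := by
  have h1 (k : G) : (avgMatrix G * regMatrix g) 1 k = avgMatrix G 1 k := by
    simp only [Matrix.mul_apply, regMatrix, avgMatrix, if_true, mul_ite, mul_one, mul_zero]
    have (x : G) : k = g⁻¹ * x ↔ x = g * k := by
      rw [eq_inv_mul_iff_mul_eq, eq_comm]
    simp [this]
  have h3 := congrFun (congrFun (avgMatrix_mul G) 1) h
  rw [Matrix.mul_apply, Matrix.one_apply] at h3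
  rw [rep, Matrix.mul_apply]
  simp only [h1, h3, eq_comm]

end Matrix

section Actions

variable {G A : Type*} [Group G] [NonUnitalRing A] [Module ℂ A]

/-- The automorphism of `A` given by `g`, as a linear equivalence. -/
def algEquiv (α : AlgAction G A) (g : G) : A ≃ₗ[ℂ] A where
  toFun := α.act g
  map_add' := α.map_add g
  map_smul' := α.map_csmul g
  invFun := α.act g⁻¹
  left_inv x := by rw [← α.act_mul, inv_mul_cancel, α.act_one]
  right_inv x := by rw [← α.act_mul, mul_inv_cancel, α.act_one]

/-- The entrywise action on `A^n`. -/
def coordEquiv (α : AlgAction G A) (n : Type*) (g : G) : (n →₀ A) ≃ₗ[ℂ] (n →₀ A) :=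
  Finsupp.mapRange.linearEquiv (algEquiv α g)

theorem coordEquiv_apply (α : AlgAction G A) {n : Type*} (g : G) (x : n →₀ A) (i : n) :
    coordEquiv α n g x i = α.act g (x i) := rfl

theorem coordEquiv_symm (α : AlgAction G A) {n : Type*} (g : G) (x : n →₀ A) :
    (coordEquiv α n g).symm x = coordEquiv α n g⁻¹ x := rfl

theorem coordEquiv_mul (α : AlgAction G A) {n : Type*} (g h : G) (x : n →₀ A) :
    coordEquiv α n (g * h) x = coordEquiv α n g (coordEquiv α n h x) := by
  ext i
  simp only [coordEquiv_apply, α.act_mul]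

/-- The action of `g` on a module, as a linear equivalence. -/
def modEquiv {E : Type*} [AddCommGroup E] [Module ℂ E] {α : AlgAction G A} {r : RightMod A E}
    (S : ModAction G α r) (g : G) : E ≃ₗ[ℂ] E where
  toFun := S.act g
  map_add' := S.map_add g
  map_smul' := S.map_csmul g
  invFun := S.act g⁻¹
  left_inv x := by rw [← S.act_mul, inv_mul_cancel, S.act_one]
  right_inv x := by rw [← S.act_mul, mul_inv_cancel, S.act_one]

/-- Right multiplication by an element of the algebra, as a linear map. -/
def smLin {E : Type*} [AddCommGroup E] [Module ℂ E] (r : RightMod A E) (a : A) : E →ₗ[ℂ] E where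
  toFun x := r.sm x a
  map_add' x y := r.add_sm x y a
  map_smul' c x := r.csm_left c x a

/-- The action `S ⊗ rep` on `E ⊗ ℂ^G`. -/
def diagAction [Fintype G] [DecidableEq G] {E : Type*} [AddCommGroup E] [Module ℂ E]
    {α : AlgAction G A} {r : RightMod A E} (S : ModAction G α r) : ModAction G α (piMod r G) where
  act g z := mix (rep g) fun h => S.act g (z h)
  map_add g x y := by
    rw [← map_add]
    congr 1
    funext h
    exact S.map_add g _ _
  map_csmul g c x := by
    rw [← map_smul]
    congr 1
    funext h
    exact S.map_csmul g _ _
  act_sm g x a := by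
    change mix (rep g) (fun h => S.act g (r.sm (x h) a)) = _
    simp only [S.act_sm]
    exact mix_map (rep g) (smLin r (α.act g a)) _
  act_one x := by simp only [rep_one, mix_one, S.act_one]
  act_mul g h x := by
    simp only [rep_mul, mix_mul, S.act_mul]
    congr 1
    exact mix_map (rep h) (modEquiv S g).toLinearMap fun k => S.act h (x k)

theorem diagAction_ite [Fintype G] [DecidableEq G] {E : Type*} [AddCommGroup E] [Module ℂ E]
    {α : AlgAction G A} {r : RightMod A E} (S : ModAction G α r) (g h : G) (ξ : E) :
    (diagAction S).act g (fun k => if k = h then ξ else 0) = fun k => rep g k h • S.act g ξ := by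
  rw [← mix_ite]
  change mix _ (fun k => S.act g (if k = h then ξ else 0)) = _
  congr 1
  funext k
  split_ifs
  · rfl
  · exact map_zero (modEquiv S g)

theorem diagAction_apply_one [Fintype G] [DecidableEq G] {E : Type*} [AddCommGroup E] [Module ℂ E]
    {α : AlgAction G A} {r : RightMod A E} (S : ModAction G α r) (g : G) (z : G → E) :
    (diagAction S).act g z 1 = S.act g (z 1) := by
  change mix _ _ _ = _
  simp [mix_apply, rep_one_apply]

variable (G) in
/-- The representation `rep` on `ℂ^G`. -/
def repAction [Fintype G] [DecidableEq G] : LinAction G (G →₀ ℂ) where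
  act g v := (Finsupp.linearEquivFunOnFinite ℂ ℂ G).symm (mix (rep g) v)
  map_add g x y := by
    rw [Finsupp.coe_add, map_add, map_add]
  map_csmul g c x := by
    rw [Finsupp.coe_smul, map_smul, map_smul]
  act_one x := by
    rw [rep_one, mix_one]
    exact (Finsupp.linearEquivFunOnFinite ℂ ℂ G).symm_apply_apply x
  act_mul g h x := by
    rw [rep_mul, mix_mul]
    rfl

theorem repAction_single [Fintype G] [DecidableEq G] (g h k : G) :
    (repAction G).act g (Finsupp.single h 1) k = rep g k h := by
  change mix (rep g) (Finsupp.single h (1 : ℂ)) k = _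
  simp [mix_apply, Finsupp.single_apply]

/-- Translation of the second index. -/
def shift (n : Type*) (g : G) : n × G ≃ n × G := (Equiv.refl n).prodCongr (Equiv.mulLeft g)

theorem shift_symm_apply {n : Type*} (g : G) (i : n) (h : G) :
    (shift n g).symm (i, h) = (i, g⁻¹ * h) := rfl

variable (G) in
/-- The trivial representation on `ℂ^n` tensored with the regular representation. -/
def shiftAction (n : Type*) : LinAction G ((n × G) →₀ ℂ) where
  act g v := Finsupp.equivMapDomain (shift n g) v
  map_add g x y := by ext p; simp
  map_csmul g c x := by ext p; simp
  act_one x := by ext ⟨i, k⟩; simp [shift_symm_apply]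
  act_mul g h x := by ext ⟨i, k⟩; simp [shift_symm_apply, mul_assoc]

end Actions

section Standard

variable {G A : Type*} [Group G] [NonUnitalRing A] [Module ℂ A]
  [SMulCommClass ℂ A A] [IsScalarTower ℂ A A]

theorem stdMod_sm_apply {n : Type*} (x : n →₀ A) (a : A) (i : n) :
    (stdMod A n).sm x a i = x i * a := rfl

theorem coordEquiv_sm (α : AlgAction G A) {n : Type*} (g : G) (x : n →₀ A) (a : A) :
    coordEquiv α n g ((stdMod A n).sm x a) = (stdMod A n).sm (coordEquiv α n g x) (α.act g a) := by
  ext i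
  simp only [coordEquiv_apply, stdMod_sm_apply, α.map_mul]

/-- The action `α ⊗ ν` on `A^{n·|G|}`, where `ν` permutes the basis. -/
def shiftModAction (α : AlgAction G A) (n : Type*) : ModAction G α (stdMod A (n × G)) where
  act g x := coordEquiv α (n × G) g (Finsupp.equivMapDomain (shift n g) x)
  map_add g x y := by ext p; simp [coordEquiv_apply, α.map_add]
  map_csmul g c x := by ext p; simp [coordEquiv_apply, α.map_csmul]
  act_sm g x a := by ext p; simp [coordEquiv_apply, stdMod_sm_apply, α.map_mul]
  act_one x := by ext ⟨i, k⟩; simp [coordEquiv_apply, shift_symm_apply, α.act_one]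
  act_mul g h x := by
    ext ⟨i, k⟩
    simp [coordEquiv_apply, shift_symm_apply, α.act_mul, mul_assoc]

theorem shiftModAction_apply (α : AlgAction G A) {n : Type*} (g : G) (x : (n × G) →₀ A)
    (i : n) (h : G) :
    (shiftModAction α n).act g x (i, h) = α.act g (x (i, g⁻¹ * h)) := rfl

theorem shiftModAction_single (α : AlgAction G A) (n : Type*) (g : G) (p : n × G) (a : A) :
    (shiftModAction α n).act g (Finsupp.single p a) =
      ((shiftAction G n).act g (Finsupp.single p 1)).sum
        fun q c => Finsupp.single q (c • α.act g a) := by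
  change Finsupp.mapRange.linearEquiv (algEquiv α g) (Finsupp.equivMapDomain _ _) =
    (Finsupp.equivMapDomain _ _).sum _
  rw [Finsupp.equivMapDomain_single, Finsupp.equivMapDomain_single, Finsupp.sum_single_index]
  · simp [algEquiv]
  · simp

theorem zero_mem_stdTheta {n : Type*} : (fun _ => 0) ∈ stdTheta A n := ⟨0, by simp⟩

theorem add_mem_stdTheta {n : Type*} {φ ψ : (n →₀ A) → A} (hφ : φ ∈ stdTheta A n)
    (hψ : ψ ∈ stdTheta A n) : (fun ξ => φ ξ + ψ ξ) ∈ stdTheta A n := by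
  obtain ⟨x, hx⟩ := hφ
  obtain ⟨y, hy⟩ := hψ
  refine ⟨x + y, fun ξ => ?_⟩
  rw [Finsupp.sum_add_index' (by simp) (by simp [add_mul]), ← hx, ← hy]

theorem smul_mem_stdTheta {n : Type*} {φ : (n →₀ A) → A} (c : ℂ) (hφ : φ ∈ stdTheta A n) :
    (fun ξ => c • φ ξ) ∈ stdTheta A n := by
  obtain ⟨x, hx⟩ := hφ
  refine ⟨c • x, fun ξ => ?_⟩
  rw [Finsupp.sum_smul_index' (by simp)]
  simp [hx, Finsupp.smul_sum, smul_mul_assoc]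

theorem sum_mem_stdTheta {n ι : Type*} (s : Finset ι) {φ : ι → (n →₀ A) → A}
    (hφ : ∀ i, φ i ∈ stdTheta A n) : (fun ξ => ∑ i ∈ s, φ i ξ) ∈ stdTheta A n := by
  classical
  induction s using Finset.induction_on with
  | empty => simpa using zero_mem_stdTheta
  | insert i s hi ih =>
    simp only [Finset.sum_insert hi]
    exact add_mem_stdTheta (hφ i) ih

theorem map_add_of_mem_stdTheta {n : Type*} {φ : (n →₀ A) → A} (hφ : φ ∈ stdTheta A n)
    (x y : n →₀ A) : φ (x + y) = φ x + φ y := by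
  obtain ⟨z, hz⟩ := hφ
  simp [hz, mul_add, Finsupp.sum_add]

theorem map_smul_of_mem_stdTheta {n : Type*} {φ : (n →₀ A) → A} (hφ : φ ∈ stdTheta A n)
    (c : ℂ) (x : n →₀ A) : φ (c • x) = c • φ x := by
  obtain ⟨z, hz⟩ := hφ
  simp [hz, mul_smul_comm, Finsupp.smul_sum]

theorem twist_mem_stdTheta (α : AlgAction G A) {n : Type*} (g : G) {φ : (n →₀ A) → A}
    (hφ : φ ∈ stdTheta A n) : (fun ξ => α.act g (φ (coordEquiv α n g⁻¹ ξ))) ∈ stdTheta A n := by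
  obtain ⟨x, hx⟩ := hφ
  refine ⟨coordEquiv α n g x, fun ξ => ?_⟩
  have h1 : coordEquiv α n g x = Finsupp.mapRange (algEquiv α g) (map_zero _) x := rfl
  beta_reduce
  rw [hx, h1, Finsupp.sum_mapRange_index (by simp)]
  change algEquiv α g _ = _
  rw [map_finsuppSum]
  refine Finsupp.sum_congr fun i _ => ?_
  change α.act g (_ * α.act g⁻¹ _) = α.act g _ * _
  rw [α.map_mul, ← α.act_mul, mul_inv_cancel, α.act_one]

variable [Fintype G]

variable (G A) in
/-- The identification of `A^{n·|G|}` with `A^n ⊗ ℂ^{|G|}`. -/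
def curryEquiv (n : Type*) : ((n × G) →₀ A) ≃ₗ[ℂ] (G → (n →₀ A)) :=
  (Finsupp.domLCongr (Equiv.prodComm n G)).trans
    ((Finsupp.curryLinearEquiv ℂ).trans (Finsupp.linearEquivFunOnFinite ℂ (n →₀ A) G))

theorem curryEquiv_apply {n : Type*} (x : (n × G) →₀ A) (h : G) (i : n) :
    curryEquiv G A n x h i = x (i, h) := by
  simp [curryEquiv, Finsupp.curryLinearEquiv]

theorem sum_curryEquiv {n : Type*} (x ξ : (n × G) →₀ A) :
    x.sum (fun p a => a * ξ p) =
      ∑ h, (curryEquiv G A n x h).sum fun i a => a * curryEquiv G A n ξ h i := by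
  classical
  induction x using Finsupp.induction_linear with
  | zero => simp
  | add x y hx hy =>
    rw [Finsupp.sum_add_index' (by simp) (by simp [add_mul]), hx, hy, ← Finset.sum_add_distrib]
    refine Finset.sum_congr rfl fun h _ => ?_
    rw [map_add, Pi.add_apply, Finsupp.sum_add_index' (by simp) (by simp [add_mul])]
  | single p a =>
    have h1 (h : G) : curryEquiv G A n (Finsupp.single p a) h =
        if h = p.2 then Finsupp.single p.1 a else 0 := by
      ext i
      rw [curryEquiv_apply]
      by_cases hh : h = p.2
      · simp [hh, Finsupp.single_apply, Prod.ext_iff]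
      · simp [hh, Prod.ext_iff]
    rw [Finsupp.sum_single_index (by simp), Finset.sum_eq_single p.2]
    · rw [h1, if_pos rfl, Finsupp.sum_single_index (by simp), curryEquiv_apply]
    · intro h _ hh
      rw [h1, if_neg hh, Finsupp.sum_zero_index]
    · simp

theorem comp_curryEquiv_mem {n : Type*} {F : (G → (n →₀ A)) → A}
    (hF : F ∈ piTheta G (stdTheta A n)) :
    (fun x => F (curryEquiv G A n x)) ∈ stdTheta A (n × G) := by
  obtain ⟨χ, hχ, hF⟩ := hF
  choose x hx using hχ
  refine ⟨(curryEquiv G A n).symm x, fun ξ => ?_⟩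
  beta_reduce
  rw [hF, sum_curryEquiv]
  simp only [LinearEquiv.apply_symm_apply, hx]

theorem comp_curryEquiv_symm_mem {n : Type*} {f : ((n × G) →₀ A) → A}
    (hf : f ∈ stdTheta A (n × G)) :
    (fun z => f ((curryEquiv G A n).symm z)) ∈ piTheta G (stdTheta A n) := by
  obtain ⟨x, hx⟩ := hf
  refine ⟨fun h ξ => (curryEquiv G A n x h).sum fun i a => a * ξ i,
    fun h => ⟨curryEquiv G A n x h, fun _ => rfl⟩, fun z => ?_⟩
  beta_reduce
  rw [hx, sum_curryEquiv]
  simp only [LinearEquiv.apply_symm_apply]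

theorem comp_mix_mem {n : Type*} (c : Matrix G G ℂ) {F : (G → (n →₀ A)) → A}
    (hF : F ∈ piTheta G (stdTheta A n)) :
    (fun z => F (mix c z)) ∈ piTheta G (stdTheta A n) := by
  obtain ⟨χ, hχ, hF⟩ := hF
  refine ⟨fun h ξ => ∑ g, c g h • χ g ξ,
    fun h => sum_mem_stdTheta _ fun g => smul_mem_stdTheta _ (hχ g), fun z => ?_⟩
  beta_reduce
  rw [hF, Finset.sum_comm]
  refine Finset.sum_congr rfl fun g _ => ?_
  let L : (n →₀ A) →ₗ[ℂ] A :=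
    { toFun := χ g
      map_add' := map_add_of_mem_stdTheta (hχ g)
      map_smul' := map_smul_of_mem_stdTheta (hχ g) }
  change L (∑ h, c g h • z h) = ∑ h, c g h • L (z h)
  simp

theorem comp_pi_mem {n : Type*} (T : G → (n →₀ A) → (n →₀ A))
    (hT : ∀ h, ∀ φ ∈ stdTheta A n, (fun ξ => φ (T h ξ)) ∈ stdTheta A n)
    {F : (G → (n →₀ A)) → A} (hF : F ∈ piTheta G (stdTheta A n)) :
    (fun z => F (fun h => T h (z h))) ∈ piTheta G (stdTheta A n) := by
  obtain ⟨χ, hχ, hF⟩ := hF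
  exact ⟨fun h ξ => χ h (T h ξ), fun h => hT h _ (hχ h), fun z => hF _⟩

variable {n : Type*} {α : AlgAction G A} (S : ModAction G α (stdMod A n))

/-- The `A`-linear automorphism `S_h ∘ α_{h⁻¹}` of `A^n`. -/
def untwist (h : G) : (n →₀ A) ≃ₗ[ℂ] (n →₀ A) := (coordEquiv α n h⁻¹).trans (modEquiv S h)

theorem untwist_apply (h : G) (ξ : n →₀ A) :
    untwist S h ξ = S.act h (coordEquiv α n h⁻¹ ξ) := rfl

theorem untwist_symm_apply (h : G) (ξ : n →₀ A) :
    (untwist S h).symm ξ = coordEquiv α n h (S.act h⁻¹ ξ) := by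
  rw [LinearEquiv.symm_apply_eq, untwist_apply, ← coordEquiv_symm, LinearEquiv.symm_apply_apply,
    ← S.act_mul, mul_inv_cancel, S.act_one]

theorem untwist_sm (h : G) (ξ : n →₀ A) (a : A) :
    untwist S h ((stdMod A n).sm ξ a) = (stdMod A n).sm (untwist S h ξ) a := by
  rw [untwist_apply, coordEquiv_sm, S.act_sm, ← α.act_mul, mul_inv_cancel, α.act_one, untwist_apply]

variable {S}

theorem comp_untwist_mem (hinv : ThetaInvariant α S (stdTheta A n)) (h : G)
    {φ : (n →₀ A) → A} (hφ : φ ∈ stdTheta A n) :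
    (fun ξ => φ (untwist S h ξ)) ∈ stdTheta A n := by
  have := twist_mem_stdTheta α h (hinv h⁻¹ φ hφ)
  simpa only [inv_inv, ← α.act_mul, mul_inv_cancel, α.act_one, untwist_apply] using this

theorem comp_untwist_symm_mem (hinv : ThetaInvariant α S (stdTheta A n)) (h : G)
    {φ : (n →₀ A) → A} (hφ : φ ∈ stdTheta A n) :
    (fun ξ => φ ((untwist S h).symm ξ)) ∈ stdTheta A n := by
  have := hinv h _ (twist_mem_stdTheta α h⁻¹ hφ)
  simpa only [inv_inv, ← α.act_mul, mul_inv_cancel, α.act_one, untwist_symm_apply] using this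

variable (S) [DecidableEq G]

/-- The isomorphism `A ⊗ ℂ^{n·|G|} ≃ A^n ⊗ ℂ^{|G|}` intertwining `α ⊗ ν` and `S ⊗ μ`. -/
def stabEquiv : ((n × G) →₀ A) ≃ₗ[ℂ] (G → (n →₀ A)) :=
  (curryEquiv G A n).trans ((LinearEquiv.piCongrRight (untwist S)).trans
    (mixEquiv (avgMatrix G) (avgMatrixInv G) (avgMatrix_mul G)))

theorem stabEquiv_apply (x : (n × G) →₀ A) :
    stabEquiv S x = mix (avgMatrix G) fun h => untwist S h (curryEquiv G A n x h) := rfl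

theorem stabEquiv_sm (x : (n × G) →₀ A) (a : A) :
    stabEquiv S ((stdMod A (n × G)).sm x a) =
      (piMod (stdMod A n) G).sm (stabEquiv S x) a := by
  have h1 (h : G) : curryEquiv G A n ((stdMod A (n × G)).sm x a) h =
      (stdMod A n).sm (curryEquiv G A n x h) a := by
    ext i
    simp only [curryEquiv_apply, stdMod_sm_apply]
  simp only [stabEquiv_apply, h1, untwist_sm]
  exact mix_map (avgMatrix G) (smLin (stdMod A n) a) _

theorem stabEquiv_act (g : G) (x : (n × G) →₀ A) :
    stabEquiv S ((shiftModAction α n).act g x) = (diagAction S).act g (stabEquiv S x) := by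
  have h1 (h : G) : curryEquiv G A n ((shiftModAction α n).act g x) h =
      coordEquiv α n g (curryEquiv G A n x (g⁻¹ * h)) := by
    ext i
    simp only [curryEquiv_apply, shiftModAction_apply, coordEquiv_apply]
  have h2 : (fun h => S.act g (stabEquiv S x h)) =
      mix (avgMatrix G) fun h => S.act g (untwist S h (curryEquiv G A n x h)) :=
    (mix_map (avgMatrix G) (modEquiv S g).toLinearMap _).symm
  change _ = mix (rep g) (fun h => S.act g (stabEquiv S x h))
  rw [h2, ← mix_mul, rep, mul_assoc, avgMatrixInv_mul, mul_one, mix_mul, mix_regMatrix,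
    stabEquiv_apply]
  congr 1
  funext h
  rw [h1, untwist_apply, untwist_apply, ← S.act_mul, ← coordEquiv_mul, mul_inv_cancel_left]
  simp

theorem stabEquiv_symm_act (g : G) (z : G → (n →₀ A)) :
    (stabEquiv S).symm ((diagAction S).act g z) =
      (shiftModAction α n).act g ((stabEquiv S).symm z) := by
  rw [LinearEquiv.symm_apply_eq, stabEquiv_act, LinearEquiv.apply_symm_apply]

variable {S}

theorem comp_stabEquiv_mem (hinv : ThetaInvariant α S (stdTheta A n))
    {F : (G → (n →₀ A)) → A} (hF : F ∈ piTheta G (stdTheta A n)) :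
    (fun x => F (stabEquiv S x)) ∈ stdTheta A (n × G) :=
  comp_curryEquiv_mem (comp_pi_mem (fun h => untwist S h)
    (fun h _ hφ => comp_untwist_mem hinv h hφ) (comp_mix_mem (avgMatrix G) hF))

theorem comp_stabEquiv_symm_mem (hinv : ThetaInvariant α S (stdTheta A n))
    {f : ((n × G) →₀ A) → A} (hf : f ∈ stdTheta A (n × G)) :
    (fun z => f ((stabEquiv S).symm z)) ∈ piTheta G (stdTheta A n) :=
  comp_mix_mem (avgMatrixInv G) (comp_pi_mem (fun h => (untwist S h).symm)
    (fun h _ hφ => comp_untwist_symm_mem hinv h hφ) (comp_curryEquiv_symm_mem hf))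

theorem comp_eval_mem {φ : (n →₀ A) → A} (hφ : φ ∈ stdTheta A n) (h : G) :
    (fun z : G → (n →₀ A) => φ (z h)) ∈ piTheta G (stdTheta A n) := by
  refine ⟨fun k => if k = h then φ else fun _ => 0, fun k => ?_, fun z => ?_⟩
  · dsimp only
    split_ifs
    · exact hφ
    · exact zero_mem_stdTheta
  · rw [Finset.sum_eq_single h]
    · simp
    · intro k _ hk
      simp [hk]
    · simp

end Standard

end EquivariantStabilization

end

open EquivariantStabilization

open scoped Classical in
/-- For a finite group `G` and an arbitrary `G`-action `S` on
the standard functional module `A^n`, there are a linear `G`-action `ν` on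
`ℂ^{n·|G|}`, a `G`-equivariant functional extension
`π : (A^n, S) → A^{n·|G|} = (A ⊗ ℂ^{n·|G|}, α ⊗ ν)`, a linear `G`-action `μ` on
`ℂ^{|G|}` and a `G`-equivariant isomorphism of functional modules
`(V,V^*) : (A ⊗ ℂ^{n·|G|}, α ⊗ ν) → (A^n ⊗ ℂ^{|G|}, S ⊗ μ)` such that `V ∘ π`
is the canonical embedding onto the first summand. -/
theorem std_module_equivariant_stabilization
    {G A : Type*} [Group G] [Fintype G]
    [NonUnitalRing A] [Module ℂ A] [SMulCommClass ℂ A A] [IsScalarTower ℂ A A]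
    (n : Type*) (α : AlgAction G A)
    (S : ModAction G α (stdMod A n)) (hinv : ThetaInvariant α S (stdTheta A n)) :
    ∃ (ν : LinAction G ((n × G) →₀ ℂ)) (Sν : ModAction G α (stdMod A (n × G))),
      -- `Sν` is the action `α ⊗ ν`
      (∀ (g : G) (p : n × G) (a : A),
        Sν.act g (Finsupp.single p a) =
          (ν.act g (Finsupp.single p 1)).sum fun q c => Finsupp.single q (c • α.act g a)) ∧
      ∃ (π : (n →₀ A) → ((n × G) →₀ A))
        (πstar : ((n →₀ A) → A) → ((n × G) →₀ A) → A),
        -- `π` is a `G`-equivariant functional extension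
        IsFunctionalExtension (stdMod A n) (stdTheta A n)
          (stdMod A (n × G)) (stdTheta A (n × G)) π πstar ∧
        (∀ (g : G) (ξ : n →₀ A), π (S.act g ξ) = Sν.act g (π ξ)) ∧
        (∀ (g : G), ∀ φ ∈ stdTheta A n,
          πstar (fun ξ => α.act g (φ (S.act g⁻¹ ξ))) =
            fun y => α.act g (πstar φ (Sν.act g⁻¹ y))) ∧
        ∃ (μ : LinAction G (G →₀ ℂ))
          (SGm : ModAction G α (piMod (stdMod A n) G)),
          -- `SGm` is the diagonal action `S ⊗ μ` on `A^n ⊗ ℂ^{|G|}`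
          (∀ (g h : G) (ξ : n →₀ A),
            SGm.act g (fun h' => if h' = h then ξ else 0) =
              fun h' => (μ.act g (Finsupp.single h 1)) h' • S.act g ξ) ∧
          ∃ (V : ((n × G) →₀ A) → (G → (n →₀ A)))
            (Vstar : (((n × G) →₀ A) → A) → (G → (n →₀ A)) → A),
            -- `(V, V^*)` is a `G`-equivariant isomorphism of functional modules
            IsFunctionalHom (stdMod A (n × G)) (stdTheta A (n × G))
              (piMod (stdMod A n) G) (piTheta G (stdTheta A n)) V Vstar ∧
            Function.Bijective V ∧
            Set.BijOn Vstar (stdTheta A (n × G)) (piTheta G (stdTheta A n)) ∧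
            (∀ (g : G) (x : (n × G) →₀ A), V (Sν.act g x) = SGm.act g (V x)) ∧
            (∀ (g : G), ∀ f ∈ stdTheta A (n × G),
              Vstar (fun x => α.act g (f (Sν.act g⁻¹ x))) =
                fun y => α.act g (Vstar f (SGm.act g⁻¹ y))) ∧
            -- `V ∘ π` is the canonical embedding onto the first summand
            (∀ ξ : n →₀ A, V (π ξ) = fun h => if h = (1 : G) then ξ else 0) := by
  have hι : IsModHom (stdMod A n) (piMod (stdMod A n) G)
      (fun ξ h => if h = (1 : G) then ξ else 0) := by
    refine ⟨fun x y => ?_, fun c x => ?_, fun x a => ?_⟩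
    · funext h
      by_cases hh : h = 1 <;> simp [hh]
    · funext h
      by_cases hh : h = 1 <;> simp [hh]
    · funext h
      change _ = (stdMod A n).sm _ a
      by_cases hh : h = 1
      · simp [hh]
      · simp only [if_neg hh]
        exact (map_zero (smLin (stdMod A n) a)).symm
  have hsm (z : G → (n →₀ A)) (a : A) : (stabEquiv S).symm ((piMod (stdMod A n) G).sm z a) =
      (stdMod A (n × G)).sm ((stabEquiv S).symm z) a := by
    rw [LinearEquiv.symm_apply_eq, stabEquiv_sm, LinearEquiv.apply_symm_apply]
  refine ⟨shiftAction G n, shiftModAction α n, shiftModAction_single α n,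
    fun ξ => (stabEquiv S).symm fun h => if h = 1 then ξ else 0,
    fun φ y => φ (stabEquiv S y 1), ?_, fun g ξ => ?_, fun g φ _ => ?_,
    repAction G, diagAction S, fun g h ξ => ?_,
    stabEquiv S, fun f z => f ((stabEquiv S).symm z), ?_, (stabEquiv S).bijective, ?_,
    stabEquiv_act S, fun g f _ => ?_, fun ξ => (stabEquiv S).apply_symm_apply _⟩
  · exact
      { hom := ⟨fun x y => (congrArg _ (hι.1 x y)).trans (map_add _ _ _),
          fun c x => (congrArg _ (hι.2.1 c x)).trans (map_smul _ _ _),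
          fun x a => (congrArg _ (hι.2.2 x a)).trans (hsm _ a)⟩
        maps_mem := fun hφ => comp_stabEquiv_mem hinv (comp_eval_mem hφ 1)
        star_add := fun _ _ => rfl
        star_csmul := fun _ _ _ => rfl
        star_lsmul := fun _ _ _ => rfl
        compat := fun _ x => by simp
        inj := fun x y hxy => by
          simpa using congrFun ((stabEquiv S).symm.injective hxy) 1
        lift := fun _ _ _ η => ⟨stabEquiv S η 1, fun _ => rfl⟩ }
  · rw [← stabEquiv_symm_act, diagAction_ite]
    refine congrArg (stabEquiv S).symm (funext fun h => ?_)
    by_cases hh : h = 1 <;> simp [rep_apply_one, hh]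
  · funext y
    beta_reduce
    rw [stabEquiv_act, diagAction_apply_one]
  · simp only [diagAction_ite, repAction_single]
  · exact
      { hom := ⟨map_add _, map_smul _, stabEquiv_sm S⟩
        maps_mem := fun hf => comp_stabEquiv_symm_mem hinv hf
        star_add := fun _ _ => rfl
        star_csmul := fun _ _ _ => rfl
        star_lsmul := fun _ _ _ => rfl
        compat := fun _ x => by simp }
  · refine ⟨fun f hf => comp_stabEquiv_symm_mem hinv hf, fun f _ f' _ hff => ?_,
      fun F hF => ⟨_, comp_stabEquiv_mem hinv hF, ?_⟩⟩
    · funext x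
      simpa using congrFun hff (stabEquiv S x)
    · simp
  · funext z
    beta_reduce
    rw [stabEquiv_symm_act]
end

section
/- Let A be an associative, not necessarily unital ℂ-algebra with a two-sided approximate unit and let n be any index set. Then for the standard right functional A-module A^n: (a) A^n is cofull; (b) its functional space Θ_A(A^n) = A^n is cofull; (c) the compact operator algebra K_A(A^n) has a two-sided approximate unit; and (d) the identity pair (id, id) : A^n → A^n is a functional extension. -/
open scoped BigOperators TensorProduct

section LocalUnits

variable {A : Type*} [NonUnitalRing A]

/-- Finitely many vectors of `A^n` are supported in a common finite set, and their coordinates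
admit a common two-sided unit. -/
theorem HasTwoSidedApproxUnit.exists_finset_unit (hA : HasTwoSidedApproxUnit A) {n : Type*}
    {ι : Type*} [Finite ι] (x : ι → n →₀ A) :
    ∃ (S : Finset n) (u : A), ∀ k j,
      (j ∉ S → x k j = 0) ∧ u * x k j = x k j ∧ x k j * u = x k j := by
  classical
  cases nonempty_fintype ι
  let S : Finset n := Finset.univ.biUnion fun k => (x k).support
  have hS : ∀ k j, j ∉ S → x k j = 0 := by
    intro k j hj
    by_contra h
    exact hj (Finset.mem_biUnion.2 ⟨k, Finset.mem_univ k, Finsupp.mem_support_iff.2 h⟩)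
  let e := Fintype.equivFin (ι × S)
  obtain ⟨u, hu⟩ := hA _ fun p => x (e.symm p).1 (e.symm p).2
  refine ⟨S, u, fun k j => ⟨hS k j, ?_⟩⟩
  by_cases hj : j ∈ S
  · simpa using hu (e (k, ⟨j, hj⟩))
  · simp [hS k j hj]

theorem coord_mem_stdTheta {n : Type*} (i : n) (u : A) :
    (fun ξ : n →₀ A => u * ξ i) ∈ stdTheta A n :=
  ⟨Finsupp.single i u, fun ξ => by simp⟩

variable [Module ℂ A] [SMulCommClass ℂ A A] [IsScalarTower ℂ A A]

theorem stdMod_sm_apply {n : Type*} (x : n →₀ A) (a : A) (j : n) :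
    (stdMod A n).sm x a j = x j * a := rfl

/-- The operator `Σ_{i ∈ S} θ_{u e_i, u e_i}` on `A^n`, multiplying the coordinates in `S` by
`u * u` and killing the others. -/
noncomputable def localUnit {n : Type*} (S : Finset n) (u : A) : (n →₀ A) → n →₀ A :=
  ∑ i ∈ S, elemOp (stdMod A n) (Finsupp.single i u) fun ξ => u * ξ i

theorem localUnit_mem_KSet {n : Type*} (S : Finset n) (u : A) :
    localUnit S u ∈ KSet (stdMod A n) (stdTheta A n) :=
  ⟨S.card, fun k => Finsupp.single (S.equivFin.symm k : n) u,
    fun k ξ => u * ξ (S.equivFin.symm k), fun _ => coord_mem_stdTheta _ _,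
    ((S.equivFin.symm.sum_comp fun i : S =>
      elemOp (stdMod A n) (Finsupp.single (i : n) u) fun ξ => u * ξ i).trans
        (S.sum_coe_sort fun i =>
          elemOp (stdMod A n) (Finsupp.single i u) fun ξ => u * ξ i)).symm⟩

theorem localUnit_apply_of_mem {n : Type*} {S : Finset n} (u : A) (ξ : n →₀ A) {j : n}
    (hj : j ∈ S) : localUnit S u ξ j = u * (u * ξ j) := by
  classical
  simp [localUnit, elemOp, stdMod_sm_apply, Finsupp.single_apply, ite_mul, hj]

theorem localUnit_apply_of_notMem {n : Type*} {S : Finset n} (u : A) (ξ : n →₀ A) {j : n}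
    (hj : j ∉ S) : localUnit S u ξ j = 0 := by
  classical
  simp [localUnit, elemOp, stdMod_sm_apply, Finsupp.single_apply, ite_mul, hj]

theorem localUnit_eq_self {n : Type*} {S : Finset n} {u : A} {x : n →₀ A}
    (hS : ∀ j, j ∉ S → x j = 0) (hu : ∀ j, u * x j = x j) : localUnit S u x = x := by
  ext j
  by_cases hj : j ∈ S
  · rw [localUnit_apply_of_mem u x hj, hu, hu]
  · rw [localUnit_apply_of_notMem u x hj, hS j hj]

theorem sum_mul_localUnit {n : Type*} {S : Finset n} {u : A} {y : n →₀ A}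
    (hS : ∀ j, j ∉ S → y j = 0) (hu : ∀ j, y j * u = y j) (ξ : n →₀ A) :
    (y.sum fun i yi => yi * localUnit S u ξ i) = y.sum fun i yi => yi * ξ i := by
  refine Finset.sum_congr rfl fun j _ => ?_
  by_cases hj : j ∈ S
  · simp only [localUnit_apply_of_mem u ξ hj, ← mul_assoc, hu]
  · simp [hS j hj]

theorem cofullModule_std (hA : HasTwoSidedApproxUnit A) (n : Type*) :
    CofullModule (stdMod A n) (stdTheta A n) := by
  intro x
  obtain ⟨S, u, h⟩ := hA.exists_finset_unit fun _ : Unit => x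
  obtain ⟨m, η, φ, hφ, hT⟩ := localUnit_mem_KSet S u
  refine ⟨m, η, fun _ => x, φ, hφ, ?_⟩
  have hx := localUnit_eq_self (fun j => (h () j).1) fun j => (h () j).2.1
  rw [hT] at hx
  simpa [elemOp] using hx.symm

theorem cofullTheta_std (hA : HasTwoSidedApproxUnit A) (n : Type*) :
    CofullTheta (stdMod A n) (stdTheta A n) := by
  rintro f ⟨y, hy⟩
  obtain ⟨S, u, h⟩ := hA.exists_finset_unit fun _ : Unit => y
  refine ⟨S.card, fun k => Finsupp.single (S.equivFin.symm k : n) u, fun _ => f,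
    fun k ξ => u * ξ (S.equivFin.symm k), fun _ => ⟨y, hy⟩,
    fun _ => coord_mem_stdTheta _ _, ?_⟩
  have hf : ∀ i, f (Finsupp.single i u) = y i := by
    classical
    intro i
    rw [hy, Finsupp.sum, Finset.sum_eq_single i]
    · simpa using (h () i).2.2
    · intro j _ hj
      simp [hj.symm]
    · intro hi
      simp [Finsupp.notMem_support_iff.1 hi]
  ext ξ
  have hsub : y.support ⊆ S := fun j hj => by
    by_contra hjS
    exact Finsupp.mem_support_iff.1 hj ((h () j).1 hjS)
  rw [hy, Finsupp.sum_of_support_subset y hsub _ (by simp), ← S.sum_coe_sort,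
    ← S.equivFin.symm.sum_comp, Finset.sum_apply]
  refine Finset.sum_congr rfl fun k _ => ?_
  beta_reduce
  rw [hf, ← mul_assoc, (h () _).2.2]

theorem kSetHasTwoSidedApproxUnit_std (hA : HasTwoSidedApproxUnit A) (n : Type*) :
    KSetHasTwoSidedApproxUnit (stdMod A n) (stdTheta A n) := by
  intro m T hT
  choose l η φ hφ hT using hT
  choose y hy using hφ
  obtain ⟨S, u, h⟩ := hA.exists_finset_unit
    (Sum.elim (fun p : Σ k, Fin (l k) => η p.1 p.2) fun p : Σ k, Fin (l k) => y p.1 p.2)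
  refine ⟨localUnit S u, localUnit_mem_KSet S u, fun k => ⟨?_, ?_⟩⟩
  · funext ξ
    have hTξ : ∀ j, T k ξ j = ∑ i, η k i j * φ k i ξ := fun j => by
      simp [hT k, elemOp, stdMod_sm_apply]
    refine localUnit_eq_self (fun j hj => ?_) fun j => ?_
    · rw [hTξ]
      refine Finset.sum_eq_zero fun i _ => ?_
      have h0 : η k i j = 0 := (h (.inl ⟨k, i⟩) j).1 hj
      rw [h0, zero_mul]
    · rw [hTξ, Finset.mul_sum]
      refine Finset.sum_congr rfl fun i _ => ?_
      have h1 : u * η k i j = η k i j := (h (.inl ⟨k, i⟩) j).2.1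
      rw [← mul_assoc, h1]
  · have hφ : ∀ i ξ, φ k i (localUnit S u ξ) = φ k i ξ := fun i ξ => by
      rw [hy, hy]
      exact sum_mul_localUnit (fun j => (h (.inr ⟨k, i⟩) j).1)
        (fun j => (h (.inr ⟨k, i⟩) j).2.2) ξ
    funext ξ
    simp [hT k, elemOp, hφ]

end LocalUnits

theorem isFunctionalExtension_id {A E : Type*} [NonUnitalRing A] [Module ℂ A]
    [AddCommGroup E] [Module ℂ E] (r : RightMod A E) (Θ : Set (E → A)) :
    IsFunctionalExtension r Θ r Θ id id where
  hom := ⟨fun _ _ => rfl, fun _ _ => rfl, fun _ _ => rfl⟩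
  maps_mem h := h
  star_add _ _ := rfl
  star_csmul _ _ _ := rfl
  star_lsmul _ _ _ := rfl
  compat _ _ := rfl
  inj := Function.injective_id
  lift _ _ _ η := ⟨η, fun _ => rfl⟩

/-- For an algebra `A` with two-sided approximate unit and any
index set `n`: the standard functional module `A^n` is cofull, its functional
space is cofull, `K_A(A^n)` has a two-sided approximate unit, and the identity
pair `(id, id)` is a functional extension. -/
theorem std_module_cofull_and_unit
    {A : Type*} [NonUnitalRing A] [Module ℂ A]
    [SMulCommClass ℂ A A] [IsScalarTower ℂ A A]
    (hA : HasTwoSidedApproxUnit A) (n : Type*) :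
    CofullModule (stdMod A n) (stdTheta A n) ∧
    CofullTheta (stdMod A n) (stdTheta A n) ∧
    KSetHasTwoSidedApproxUnit (stdMod A n) (stdTheta A n) ∧
    IsFunctionalExtension (stdMod A n) (stdTheta A n) (stdMod A n) (stdTheta A n)
      id id := by
  exact ⟨cofullModule_std hA n, cofullTheta_std hA n, kSetHasTwoSidedApproxUnit_std hA n,
    isFunctionalExtension_id _ _⟩
end
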